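/- arXiv:1908.06208 — 2 statements merged into one kernel-verified Lean document; each statement's English description precedes it below -/
import Mathlib

section
/- Let U be a real random variable with E[U⁴] < ∞ whose law is not a point mass, let V ∈ {−1,1} satisfy ℙ(V = 1 | U) = p₊(U) for a measurable p₊ : ℝ → (0,1), set Y := V and X := V·U, and let Z ∼ N(0,1) be independent of (U, V). Define G(λ₀, λ₁) := E[((λ₀Y + λ₁X − Z)₊)²]. Then G is twice continuously differentiable on ℝ² and is strongly convex with bounded Hessian: there exist constants 0 < a ≤ A < ∞ such that a·I₂ ⪯ ∇²G(λ) ⪯ A·I₂ for every λ ∈ ℝ² (equivalently, G(λ) − (a/2)|λ|² is convex and (A/2)|λ|² − G(λ) is convex). -/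
open MeasureTheory ProbabilityTheory
open scoped ProbabilityTheory

section Auxiliary

open Filter Topology

theorem hasDerivAt_max_zero_sq (x : ℝ) :
    HasDerivAt (fun x : ℝ => max x 0 ^ 2) (2 * max x 0) x := by
  rcases lt_trichotomy x 0 with hx | rfl | hx
  · rw [max_eq_right hx.le, mul_zero]
    refine (hasDerivAt_const x (0 : ℝ)).congr_of_eventuallyEq ?_
    filter_upwards [gt_mem_nhds hx] with y hy
    simp [max_eq_right hy.le]
  · rw [max_self, mul_zero, hasDerivAt_iff_isLittleO]
    refine Asymptotics.IsBigO.trans_isLittleO (g := fun y : ℝ => y ^ 2) ?_ ?_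
    · refine Asymptotics.IsBigO.of_bound 1 (Eventually.of_forall fun y => ?_)
      rcases le_total y 0 with hy | hy <;> simp [hy, sq_nonneg]
    · simpa using Asymptotics.isLittleO_pow_id (𝕜 := ℝ) one_lt_two
  · rw [max_eq_left hx.le]
    refine (by simpa using hasDerivAt_pow 2 x : HasDerivAt (fun y : ℝ => y ^ 2) (2 * x) x)
      |>.congr_of_eventuallyEq ?_
    filter_upwards [lt_mem_nhds hx] with y hy
    simp [max_eq_left hy.le]

section StandardGaussian

theorem integrable_abs_stdGaussian : Integrable (fun z : ℝ => |z|) (gaussianReal 0 1) :=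
  ((memLp_id_gaussianReal (μ := 0) (v := 1) 1).integrable (by simp)).abs

theorem integrable_sq_stdGaussian : Integrable (fun z : ℝ => z ^ 2) (gaussianReal 0 1) :=
  (memLp_id_gaussianReal (μ := 0) (v := 1) 2).integrable_sq

theorem integral_sq_stdGaussian : ∫ z, z ^ 2 ∂(gaussianReal 0 1) = 1 := by
  have h := variance_fun_id_gaussianReal (μ := 0) (v := 1)
  rw [variance_eq_integral measurable_id'.aemeasurable] at h
  simpa using h

theorem integrable_hinge (t : ℝ) : Integrable (fun z : ℝ => max (t - z) 0) (gaussianReal 0 1) := by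
  refine ((integrable_const |t|).add integrable_abs_stdGaussian).mono'
    (by fun_prop) (ae_of_all _ fun z => ?_)
  rw [Real.norm_of_nonneg (le_max_right _ _)]
  exact max_le ((le_abs_self _).trans (abs_sub _ _)) (add_nonneg (abs_nonneg _) (abs_nonneg _))

theorem integrable_hinge_sq (t : ℝ) :
    Integrable (fun z : ℝ => max (t - z) 0 ^ 2) (gaussianReal 0 1) := by
  refine ((integrable_const (2 * t ^ 2)).add (integrable_sq_stdGaussian.const_mul 2)).mono'
    (by fun_prop) (ae_of_all _ fun z => ?_)
  rw [Real.norm_of_nonneg (sq_nonneg _)]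
  rcases le_total (t - z) 0 with h | h
  · simp [h]; positivity
  · simp only [max_eq_left h, Pi.add_apply]; nlinarith [sq_nonneg (t + z)]

/-- The Gaussian smoothing of the squared hinge: `t ↦ 𝔼[(t - Z)₊²]` for `Z ∼ N(0,1)`. -/
noncomputable def gaussianHingeSq (t : ℝ) : ℝ := ∫ z, max (t - z) 0 ^ 2 ∂(gaussianReal 0 1)

/-- The derivative of `gaussianHingeSq`. -/
noncomputable def gaussianHinge (t : ℝ) : ℝ := ∫ z, 2 * max (t - z) 0 ∂(gaussianReal 0 1)

/-- The derivative of `gaussianHinge`: twice the Gaussian distribution function. -/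
noncomputable def gaussianStep (t : ℝ) : ℝ :=
  ∫ z, (Set.Iio t).indicator (fun _ => (2 : ℝ)) z ∂(gaussianReal 0 1)

theorem hasDerivAt_gaussianHingeSq (t : ℝ) :
    HasDerivAt gaussianHingeSq (gaussianHinge t) t := by
  refine (hasDerivAt_integral_of_dominated_loc_of_deriv_le (Metric.ball_mem_nhds t one_pos)
    (bound := fun z => 2 * (|t| + 1 + |z|)) (Eventually.of_forall fun s => by fun_prop)
    (integrable_hinge_sq t) (F' := fun s z => 2 * max (s - z) 0) (by fun_prop)
    (ae_of_all _ fun z s hs => ?_)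
    (((integrable_const (|t| + 1)).add integrable_abs_stdGaussian).const_mul 2)
    (ae_of_all _ fun z s _ => ?_)).2
  · rw [Real.norm_of_nonneg (by positivity)]
    gcongr
    have h1 : |s - t| < 1 := by simpa [Real.dist_eq] using hs
    have h2 : |s| ≤ |t| + 1 := by linarith [abs_sub_abs_le_abs_sub s t]
    exact max_le ((le_abs_self _).trans ((abs_sub _ _).trans (by linarith))) (by positivity)
  · exact (hasDerivAt_max_zero_sq (s - z)).comp_sub_const s z

theorem hasDerivAt_gaussianHinge (t : ℝ) :
    HasDerivAt gaussianHinge (gaussianStep t) t := by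
  refine (hasDerivAt_integral_of_dominated_loc_of_lip Filter.univ_mem
    (bound := fun _ => 2) (Eventually.of_forall fun s => by fun_prop)
    ((integrable_hinge t).const_mul 2)
    ((measurable_const.indicator measurableSet_Iio).aestronglyMeasurable)
    (ae_of_all _ fun z => ?_) (integrable_const 2) ?_).2
  · refine LipschitzOnWith.of_dist_le_mul fun x _ y _ => ?_
    rw [Real.dist_eq, Real.dist_eq, ← mul_sub, abs_mul]
    simp only [Real.coe_nnabs, abs_two]
    refine mul_le_mul_of_nonneg_left ?_ zero_le_two
    exact (abs_max_sub_max_le_abs (x - z) (y - z) 0).trans (by rw [sub_sub_sub_cancel_right])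
  · have : NullSingletonClass (gaussianReal 0 1) :=
      nullSingletonClass_gaussianReal one_ne_zero
    filter_upwards [(Set.countable_singleton t).ae_notMem (gaussianReal 0 1)] with z hz
    rcases lt_or_gt_of_ne (show z ≠ t by simpa using hz) with h | h
    · rw [Set.indicator_of_mem (by simpa using h)]
      refine (by simpa using ((hasDerivAt_id t).sub_const z).const_mul 2 :
        HasDerivAt (fun s : ℝ => 2 * (s - z)) 2 t).congr_of_eventuallyEq ?_
      filter_upwards [lt_mem_nhds h] with s hs
      rw [max_eq_left (by linarith)]
    · rw [Set.indicator_of_notMem (by simpa using h.le)]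
      refine (hasDerivAt_const t (0 : ℝ)).congr_of_eventuallyEq ?_
      filter_upwards [gt_mem_nhds h] with s hs
      rw [max_eq_right (by linarith), mul_zero]

theorem continuous_gaussianStep : Continuous gaussianStep := by
  refine continuous_iff_continuousAt.2 fun t => continuousAt_of_dominated (bound := fun _ => 2)
    (Eventually.of_forall fun s =>
      (measurable_const.indicator measurableSet_Iio).aestronglyMeasurable)
    (Eventually.of_forall fun s => ae_of_all _ fun z => ?_) (integrable_const 2) ?_
  · exact (norm_indicator_le_norm_self _ _).trans (by simp)
  · have : NullSingletonClass (gaussianReal 0 1) :=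
      nullSingletonClass_gaussianReal one_ne_zero
    filter_upwards [(Set.countable_singleton t).ae_notMem (gaussianReal 0 1)] with z hz
    rcases lt_or_gt_of_ne (show z ≠ t by simpa using hz) with h | h
    · refine (continuousAt_const (y := (2 : ℝ))).congr ?_
      filter_upwards [lt_mem_nhds h] with s hs
      rw [Set.indicator_of_mem (by simpa using hs)]
    · refine (continuousAt_const (y := (0 : ℝ))).congr ?_
      filter_upwards [gt_mem_nhds h] with s hs
      rw [Set.indicator_of_notMem (by simpa using hs.le)]

theorem abs_gaussianStep_le (t : ℝ) : |gaussianStep t| ≤ 2 := by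
  have h : ∀ z, ‖(Set.Iio t).indicator (fun _ => (2 : ℝ)) z‖ ≤ 2 := fun z =>
    (norm_indicator_le_norm_self _ _).trans (by simp)
  refine (norm_integral_le_of_norm_le_const (μ := gaussianReal 0 1) (ae_of_all _ h)).trans ?_
  simp

theorem abs_gaussianHinge_le (t : ℝ) : |gaussianHinge t| ≤ 2 * (1 + |t|) := by
  have h : |gaussianHinge t| ≤ ∫ z, (2 * |t| + 1 + z ^ 2) ∂(gaussianReal 0 1) := by
    rw [← Real.norm_eq_abs, gaussianHinge]
    refine norm_integral_le_of_norm_le (g := fun z => 2 * |t| + 1 + z ^ 2)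
      ((integrable_const _).add integrable_sq_stdGaussian) (ae_of_all _ fun z => ?_)
    rw [Real.norm_of_nonneg (by positivity)]
    have : max (t - z) 0 ≤ |t| + |z| :=
      max_le ((le_abs_self _).trans (abs_sub _ _)) (by positivity)
    nlinarith [sq_nonneg (|z| - 1), sq_abs z]
  rw [integral_add (integrable_const _) integrable_sq_stdGaussian, integral_sq_stdGaussian] at h
  simp at h
  linarith

theorem gaussianHingeSq_nonneg (t : ℝ) : 0 ≤ gaussianHingeSq t :=
  integral_nonneg fun _ => sq_nonneg _

theorem gaussianHingeSq_add_neg (t : ℝ) :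
    gaussianHingeSq t + gaussianHingeSq (-t) = t ^ 2 + 1 := by
  have h1 : gaussianHingeSq (-t) = ∫ z, max (z - t) 0 ^ 2 ∂(gaussianReal 0 1) := by
    have h := gaussianReal_map_neg (μ := 0) (v := 1)
    rw [neg_zero] at h
    rw [gaussianHingeSq]
    conv_lhs => rw [← h]
    rw [integral_map (by fun_prop) (by fun_prop)]
    congr with z
    ring_nf
  have h2 : Integrable (fun z : ℝ => max (z - t) 0 ^ 2) (gaussianReal 0 1) := by
    refine ((integrable_const (2 * t ^ 2)).add (integrable_sq_stdGaussian.const_mul 2)).mono'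
      (by fun_prop) (ae_of_all _ fun z => ?_)
    rw [Real.norm_of_nonneg (sq_nonneg _)]
    rcases le_total (z - t) 0 with h | h
    · simp [h]; positivity
    · simp only [max_eq_left h, Pi.add_apply]; nlinarith [sq_nonneg (t + z)]
  have h3 : Integrable (fun z : ℝ => z) (gaussianReal 0 1) :=
    (memLp_id_gaussianReal (μ := 0) (v := 1) 1).integrable (by simp)
  rw [h1, gaussianHingeSq, ← integral_add (integrable_hinge_sq t) h2]
  calc _ = ∫ z, (t ^ 2 - 2 * t * z + z ^ 2) ∂(gaussianReal 0 1) := by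
        congr with z
        rcases le_total z t with h | h
        · rw [max_eq_left (by linarith), max_eq_right (by linarith)]; ring
        · rw [max_eq_right (by linarith), max_eq_left (by linarith)]; ring
    _ = _ := by
        rw [integral_add (f := fun z => t ^ 2 - 2 * t * z)
          ((integrable_const _).sub (h3.const_mul _)) integrable_sq_stdGaussian,
          integral_sub (integrable_const _) (h3.const_mul _), integral_const_mul,
          integral_sq_stdGaussian, integral_id_gaussianReal]
        simp

theorem gaussianHingeSq_le (t : ℝ) : gaussianHingeSq t ≤ t ^ 2 + 1 := by
  linarith [gaussianHingeSq_add_neg t, gaussianHingeSq_nonneg (-t)]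

theorem continuous_gaussianHingeSq : Continuous gaussianHingeSq :=
  continuous_iff_continuousAt.2 fun t => (hasDerivAt_gaussianHingeSq t).continuousAt

theorem convexOn_gaussianHingeSq : ConvexOn ℝ Set.univ gaussianHingeSq := by
  refine integral_convexOn_of_integrand_ae convex_univ (ae_of_all _ fun z => ?_)
    fun t _ => integrable_hinge_sq t
  have h1 : ConvexOn ℝ Set.univ fun t : ℝ => t - z :=
    by
    simpa [sub_eq_add_neg] using! (convexOn_id (𝕜 := ℝ) (convex_univ (E := ℝ))).add_const (-z)
  exact (h1.sup (convexOn_const 0 convex_univ)).pow (fun t _ => le_max_right _ _) 2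

end StandardGaussian

section ParametricIntegral

variable {Ω E : Type*} [MeasurableSpace Ω] {μ : Measure Ω} [IsFiniteMeasure μ]
  [NormedAddCommGroup E] [NormedSpace ℝ E] {L : Ω → E →L[ℝ] ℝ} {g g' g'' : ℝ → ℝ} {K : ℝ}

theorem hasFDerivAt_integral_comp_clm (hL : AEStronglyMeasurable L μ)
    (hL2 : Integrable (fun ω => ‖L ω‖ ^ 2) μ) (hg : ∀ t, HasDerivAt g (g' t) t)
    (hg'c : Continuous g') (hgK : ∀ t, |g t| ≤ K * (1 + t ^ 2))
    (hg'K : ∀ t, |g' t| ≤ K * (1 + |t|)) (x : E) :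
    HasFDerivAt (fun x => ∫ ω, g (L ω x) ∂μ) (∫ ω, g' (L ω x) • L ω ∂μ) x := by
  have hK : 0 ≤ K := by simpa using (abs_nonneg _).trans (hg'K 0)
  have hgc : Continuous g := continuous_iff_continuousAt.2 fun t => (hg t).continuousAt
  have hLx : ∀ y, AEStronglyMeasurable (fun ω => L ω y) μ := fun y => hL.apply_continuousLinearMap y
  have hL1 : Integrable (fun ω => ‖L ω‖) μ :=
    ((memLp_two_iff_integrable_sq hL.norm).2 hL2).integrable one_le_two
  refine hasFDerivAt_integral_of_dominated_of_fderiv_le (Metric.ball_mem_nhds x one_pos)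
    (bound := fun ω => K * (‖L ω‖ + (‖x‖ + 1) * ‖L ω‖ ^ 2))
    (Eventually.of_forall fun y => hgc.comp_aestronglyMeasurable (hLx y)) ?_
    ((hg'c.comp_aestronglyMeasurable (hLx x)).smul hL)
    (ae_of_all _ fun ω y hy => ?_) ((hL1.add (hL2.const_mul _)).const_mul K)
    (ae_of_all _ fun ω y _ => (hg (L ω y)).comp_hasFDerivAt y (L ω).hasFDerivAt)
  · refine (((integrable_const (1 : ℝ)).add (hL2.const_mul (‖x‖ ^ 2))).const_mul K).mono'
      (hgc.comp_aestronglyMeasurable (hLx x)) (ae_of_all _ fun ω => (hgK _).trans ?_)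
    simp only [Pi.add_apply]
    gcongr
    rw [← mul_pow, ← sq_abs, mul_comm]
    gcongr
    exact (L ω).le_opNorm x
  · have hy' : ‖y‖ ≤ ‖x‖ + 1 := by
      have := norm_sub_norm_le y x
      have h1 : ‖y - x‖ < 1 := by simpa [dist_eq_norm] using hy
      linarith
    have h2 : |L ω y| ≤ ‖L ω‖ * (‖x‖ + 1) := ((L ω).le_opNorm y).trans (by gcongr)
    rw [norm_smul]
    calc ‖g' (L ω y)‖ * ‖L ω‖ ≤ K * (1 + ‖L ω‖ * (‖x‖ + 1)) * ‖L ω‖ := by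
          gcongr
          exact (hg'K _).trans (by gcongr)
      _ = _ := by ring

theorem contDiff_two_integral_comp_clm (hL : AEStronglyMeasurable L μ)
    (hL2 : Integrable (fun ω => ‖L ω‖ ^ 2) μ) (hg : ∀ t, HasDerivAt g (g' t) t)
    (hg' : ∀ t, HasDerivAt g' (g'' t) t) (hg'' : Continuous g'')
    (hgK : ∀ t, |g t| ≤ K * (1 + t ^ 2)) (hg'K : ∀ t, |g' t| ≤ K * (1 + |t|))
    (hg''K : ∀ t, |g'' t| ≤ K) :
    ContDiff ℝ 2 (fun x => ∫ ω, g (L ω x) ∂μ) := by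
  have hK : 0 ≤ K := (abs_nonneg _).trans (hg''K 0)
  have hg'c : Continuous g' := continuous_iff_continuousAt.2 fun t => (hg' t).continuousAt
  have hLx : ∀ y, AEStronglyMeasurable (fun ω => L ω y) μ := fun y => hL.apply_continuousLinearMap y
  have hL1 : Integrable (fun ω => ‖L ω‖) μ :=
    ((memLp_two_iff_integrable_sq hL.norm).2 hL2).integrable one_le_two
  have hmeas : ∀ y, AEStronglyMeasurable (fun ω => (g'' (L ω y) • L ω).smulRight (L ω)) μ := by
    intro y
    have hc : Continuous fun q : (E →L[ℝ] ℝ) × (E →L[ℝ] ℝ) => q.1.smulRight q.2 :=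
      ((ContinuousLinearMap.smulRightL ℝ E (E →L[ℝ] ℝ)).continuous.comp continuous_fst).clm_apply
        continuous_snd
    exact hc.comp_aestronglyMeasurable
      (((hg''.comp_aestronglyMeasurable (hLx y)).smul hL).prodMk hL)
  have hbound : ∀ ω y, ‖(g'' (L ω y) • L ω).smulRight (L ω)‖ ≤ K * ‖L ω‖ ^ 2 := by
    intro ω y
    rw [ContinuousLinearMap.norm_smulRight_apply, norm_smul, mul_assoc, ← sq]
    exact mul_le_mul_of_nonneg_right (hg''K _) (sq_nonneg _)
  refine (contDiff_succ_iff_hasFDerivAt (n := 1)).2 ⟨fun x => ∫ ω, g' (L ω x) • L ω ∂μ,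
    contDiff_one_iff_hasFDerivAt.2
      ⟨fun x => ∫ ω, (g'' (L ω x) • L ω).smulRight (L ω) ∂μ, ?_, fun x => ?_⟩,
    hasFDerivAt_integral_comp_clm hL hL2 hg hg'c hgK hg'K⟩
  · refine continuous_of_dominated hmeas (fun y => ae_of_all _ fun ω => hbound ω y)
      (hL2.const_mul K) (ae_of_all _ fun ω => ?_)
    exact (((ContinuousLinearMap.smulRightL ℝ E (E →L[ℝ] ℝ)).continuous.comp
      ((hg''.comp (L ω).continuous).smul continuous_const))).clm_apply continuous_const
  · refine hasFDerivAt_integral_of_dominated_of_fderiv_le Filter.univ_mem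
      (bound := fun ω => K * ‖L ω‖ ^ 2)
      (Eventually.of_forall fun y => (hg'c.comp_aestronglyMeasurable (hLx y)).smul hL) ?_
      (hmeas x) (ae_of_all _ fun ω y _ => hbound ω y) (hL2.const_mul K)
      (ae_of_all _ fun ω y _ => ?_)
    · refine ((hL1.add (hL2.const_mul ‖x‖)).const_mul K).mono'
        ((hg'c.comp_aestronglyMeasurable (hLx x)).smul hL) (ae_of_all _ fun ω => ?_)
      refine (norm_smul_le (g' (L ω x)) (L ω)).trans ?_
      calc ‖g' (L ω x)‖ * ‖L ω‖ ≤ K * (1 + ‖L ω‖ * ‖x‖) * ‖L ω‖ := by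
            gcongr
            refine (hg'K _).trans ?_
            gcongr
            exact (L ω).le_opNorm x
        _ = _ := by simp only [Pi.add_apply]; ring
    · have h := ((hg' (L ω y)).comp_hasFDerivAt y (L ω).hasFDerivAt).smul_const (L ω)
      refine h.congr_fderiv ?_
      ext u v
      simp [mul_assoc]

end ParametricIntegral

theorem convexOn_quadraticForm_prod {a b c : ℝ} (ha : 0 ≤ a) (hc : 0 ≤ c) (h : b ^ 2 ≤ a * c) :
    ConvexOn ℝ Set.univ
      (fun l : ℝ × ℝ => a * l.1 ^ 2 + 2 * b * (l.1 * l.2) + c * l.2 ^ 2) := by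
  have hpsd : ∀ x y : ℝ, 0 ≤ a * x ^ 2 + 2 * b * (x * y) + c * y ^ 2 := by
    intro x y
    rcases ha.eq_or_lt with rfl | ha
    · have hb : b = 0 := by nlinarith
      simp only [hb]; ring_nf; positivity
    · refine nonneg_of_mul_nonneg_right (b := _) (a := a) ?_ ha
      nlinarith [sq_nonneg (a * x + b * y), mul_nonneg (sub_nonneg.2 h) (sq_nonneg y)]
  refine ⟨convex_univ, fun x _ y _ s t hs ht hst => ?_⟩
  obtain rfl : t = 1 - s := by linarith
  have := mul_nonneg (mul_nonneg hs ht) (hpsd (x.1 - y.1) (x.2 - y.2))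
  simp only [Prod.fst_add, Prod.snd_add, Prod.smul_fst, Prod.smul_snd, smul_eq_mul]
  nlinarith

section Probability

variable {Ω : Type*} [MeasurableSpace Ω] {P : Measure Ω}

theorem integral_hinge_sq_eq_integral_gaussianHingeSq [IsProbabilityMeasure P]
    {T Z : Ω → ℝ} (hT : Measurable T) (hZ : Measurable Z) (hT2 : Integrable (fun ω => T ω ^ 2) P)
    (hlaw : P.map Z = gaussianReal 0 1) (hind : IndepFun T Z P) :
    ∫ ω, max (T ω - Z ω) 0 ^ 2 ∂P = ∫ ω, gaussianHingeSq (T ω) ∂P := by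
  have hprod := (indepFun_iff_map_prod_eq_prod_map_map hT.aemeasurable hZ.aemeasurable).1 hind
  rw [hlaw] at hprod
  have : IsProbabilityMeasure (P.map T) := Measure.isProbabilityMeasure_map hT.aemeasurable
  have hZ2 : Integrable (fun ω => Z ω ^ 2) P := by
    have h := integrable_sq_stdGaussian
    rw [← hlaw] at h
    exact h.comp_measurable hZ
  have hint : Integrable (fun ω => max (T ω - Z ω) 0 ^ 2) P := by
    refine ((hT2.const_mul 2).add (hZ2.const_mul 2)).mono' (by fun_prop) (ae_of_all _ fun ω => ?_)
    rw [Real.norm_of_nonneg (sq_nonneg _)]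
    rcases le_total (T ω - Z ω) 0 with h | h
    · simp [h]; positivity
    · simp only [max_eq_left h, Pi.add_apply]; nlinarith [sq_nonneg (T ω + Z ω)]
  have hF : Measurable fun q : ℝ × ℝ => max (q.1 - q.2) 0 ^ 2 := by fun_prop
  have hint' : Integrable (fun q : ℝ × ℝ => max (q.1 - q.2) 0 ^ 2)
      ((P.map T).prod (gaussianReal 0 1)) := by
    rw [← hprod, integrable_map_measure hF.aestronglyMeasurable (hT.prodMk hZ).aemeasurable]
    exact hint
  calc ∫ ω, max (T ω - Z ω) 0 ^ 2 ∂P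
      = ∫ q, max (q.1 - q.2) 0 ^ 2 ∂(P.map fun ω => (T ω, Z ω)) :=
        (integral_map (hT.prodMk hZ).aemeasurable hF.aestronglyMeasurable).symm
    _ = ∫ t, gaussianHingeSq t ∂(P.map T) := by rw [hprod, integral_prod _ hint']; rfl
    _ = _ := integral_map hT.aemeasurable continuous_gaussianHingeSq.aestronglyMeasurable

theorem integral_ite_eq_integral_conditional {U : Ω → ℝ} (hU : Measurable U) {S : Set Ω}
    (hS : MeasurableSet S) [DecidablePred (· ∈ S)] {p : ℝ → ℝ} (hp : Measurable p)
    (hp0 : ∀ t, 0 ≤ p t)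
    (hcond : ∀ B : Set ℝ, MeasurableSet B →
      P (S ∩ U ⁻¹' B) = ∫⁻ ω in U ⁻¹' B, ENNReal.ofReal (p (U ω)) ∂P)
    {f h : ℝ → ℝ} (hf : Measurable f) (hh : Measurable h)
    (hfint : Integrable (fun ω => f (U ω)) P) (hhint : Integrable (fun ω => h (U ω)) P)
    (hpint : Integrable (fun ω => p (U ω) * h (U ω)) P)
    (hpint' : Integrable (fun ω => p (U ω) * f (U ω)) P) :
    ∫ ω, (if ω ∈ S then f (U ω) else h (U ω)) ∂P
      = ∫ ω, (p (U ω) * f (U ω) + (1 - p (U ω)) * h (U ω)) ∂P := by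
  have hmap : (P.restrict S).map U = (P.map U).withDensity fun t => ENNReal.ofReal (p t) := by
    ext B hB
    rw [Measure.map_apply hU hB, Measure.restrict_apply (hU hB), Set.inter_comm, hcond B hB,
      withDensity_apply _ hB, setLIntegral_map hB hp.ennreal_ofReal hU]
  have key : ∀ k : ℝ → ℝ, Measurable k →
      ∫ ω in S, k (U ω) ∂P = ∫ ω, p (U ω) * k (U ω) ∂P := by
    intro k hk
    rw [← integral_map (φ := U) (f := k) hU.aemeasurable hk.aestronglyMeasurable, hmap,
      integral_withDensity_eq_integral_toReal_smul hp.ennreal_ofReal (by simp),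
      integral_map hU.aemeasurable (by fun_prop)]
    simp [ENNReal.toReal_ofReal (hp0 _)]
  have hsplit : ∫ ω, (if ω ∈ S then f (U ω) else h (U ω)) ∂P
      = ∫ ω in S, f (U ω) ∂P + ∫ ω in Sᶜ, h (U ω) ∂P :=
    integral_piecewise hS hfint.integrableOn hhint.integrableOn
  rw [hsplit, setIntegral_compl hS hhint, key f hf, key h hh,
    ← integral_sub hhint hpint, ← integral_add (g := fun ω => h (U ω) - p (U ω) * h (U ω))
      hpint' (hhint.sub hpint)]
  congr with ω
  ring

theorem map_eq_dirac_of_ae_eq_const [IsProbabilityMeasure P] {U : Ω → ℝ} {c : ℝ}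
    (h : ∀ᵐ ω ∂P, U ω = c) :
    P.map U = Measure.dirac c := by
  rw [Measure.map_congr (show U =ᵐ[P] fun _ => c from h), Measure.map_const]
  simp

/-- The second-moment matrix of `(1, U)` weighted by a positive bounded `w` is positive definite
unless `U` is almost surely constant. -/
theorem sq_integral_mul_lt_integral_mul_integral [IsProbabilityMeasure P] {U w : Ω → ℝ}
    (hU2 : Integrable (fun ω => U ω ^ 2) P) (hU : Measurable U) (hw : Measurable w)
    (hw0 : ∀ ω, 0 < w ω) (hw1 : ∀ ω, w ω ≤ 1) (hne : ∀ c, P.map U ≠ Measure.dirac c) :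
    0 < ∫ ω, w ω ∂P ∧
      (∫ ω, w ω * U ω ∂P) ^ 2 < (∫ ω, w ω ∂P) * ∫ ω, w ω * U ω ^ 2 ∂P := by
  have hb : ∀ᵐ ω ∂P, ‖w ω‖ ≤ 1 :=
    ae_of_all _ fun ω => by rw [Real.norm_of_nonneg (hw0 ω).le]; exact hw1 ω
  have hU1 : Integrable U P :=
    ((memLp_two_iff_integrable_sq hU.aestronglyMeasurable).2 hU2).integrable one_le_two
  have i0 : Integrable w P := (integrable_const (1 : ℝ)).mono' hw.aestronglyMeasurable hb
  have i1 : Integrable (fun ω => w ω * U ω) P := hU1.bdd_mul hw.aestronglyMeasurable hb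
  have i2 : Integrable (fun ω => w ω * U ω ^ 2) P := hU2.bdd_mul hw.aestronglyMeasurable hb
  have hpos : 0 < ∫ ω, w ω ∂P := by
    rw [integral_pos_iff_support_of_nonneg (fun ω => (hw0 ω).le) i0,
      show Function.support w = Set.univ from Set.eq_univ_of_forall fun ω => (hw0 ω).ne']
    simp
  refine ⟨hpos, ?_⟩
  set α := ∫ ω, w ω ∂P
  set β := ∫ ω, w ω * U ω ∂P
  set δ := ∫ ω, w ω * U ω ^ 2 ∂P
  have hexp : ∀ c : ℝ, ∫ ω, w ω * (U ω - c) ^ 2 ∂P = δ - 2 * c * β + c ^ 2 * α := by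
    intro c
    rw [← integral_const_mul, ← integral_const_mul, ← integral_sub i2 (i1.const_mul _),
      ← integral_add (f := fun ω => w ω * U ω ^ 2 - 2 * c * (w ω * U ω))
        (i2.sub (i1.const_mul _)) (i0.const_mul _)]
    congr with ω
    ring
  have hint : ∀ c : ℝ, Integrable (fun ω => w ω * (U ω - c) ^ 2) P := by
    intro c
    refine ((i2.sub (i1.const_mul (2 * c))).add (i0.const_mul (c ^ 2))).congr
      (ae_of_all _ fun ω => ?_)
    simp only [Pi.add_apply, Pi.sub_apply]
    ring
  have hlt : 0 < ∫ ω, w ω * (U ω - β / α) ^ 2 ∂P := by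
    have hnn : ∀ ω, 0 ≤ w ω * (U ω - β / α) ^ 2 := fun ω => mul_nonneg (hw0 ω).le (sq_nonneg _)
    refine (integral_nonneg hnn).lt_of_ne' fun h0 => hne (β / α) ?_
    rw [integral_eq_zero_iff_of_nonneg hnn (hint _)] at h0
    refine map_eq_dirac_of_ae_eq_const ?_
    filter_upwards [h0] with ω hω
    have := (mul_eq_zero.1 hω).resolve_left (hw0 ω).ne'
    linarith [pow_eq_zero_iff two_ne_zero |>.1 this]
  rw [hexp] at hlt
  have h2 : α * (δ - 2 * (β / α) * β + (β / α) ^ 2 * α) = α * δ - β ^ 2 := by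
    field_simp
    ring
  nlinarith [mul_pos hpos hlt]

end Probability

end Auxiliary

/- STATEMENT 8: With E[U⁴] < ∞, U non-degenerate, V ∈ {−1,1} with ℙ(V = 1 | U) = p₊(U),
Y = V, X = V·U, and Z ∼ N(0,1) independent of (U, V), the function
G(λ₀, λ₁) = E[((λ₀Y + λ₁X − Z)₊)²] is C² and strongly convex with bounded Hessian:
there are 0 < a ≤ A with G(λ) − (a/2)|λ|² convex and (A/2)|λ|² − G(λ) convex. -/
theorem G_strongly_convex
    (Ω : Type*) [MeasureSpace Ω] [IsProbabilityMeasure (ℙ : Measure Ω)]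
    (U V Z : Ω → ℝ)
    (hUmeas : Measurable U) (hVmeas : Measurable V) (hZmeas : Measurable Z)
    (hU4 : Integrable (fun ω => (U ω) ^ 4) ℙ)
    (hUnondeg : ∀ c : ℝ, Measure.map U ℙ ≠ Measure.dirac c)
    (hV : ∀ ω, V ω = 1 ∨ V ω = -1)
    (pp : ℝ → ℝ) (hppmeas : Measurable pp) (hpprange : ∀ t, pp t ∈ Set.Ioo (0 : ℝ) 1)
    (hcond : ∀ B : Set ℝ, MeasurableSet B →
      ℙ ({ω | V ω = 1} ∩ U ⁻¹' B)
        = ∫⁻ ω in U ⁻¹' B, ENNReal.ofReal (pp (U ω)) ∂ℙ)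
    (hZlaw : Measure.map Z ℙ = gaussianReal 0 1)
    (hZindep : IndepFun (fun ω => (U ω, V ω)) Z ℙ)
    (G : ℝ × ℝ → ℝ)
    (hG : ∀ lam : ℝ × ℝ,
      G lam = ∫ ω, (max (lam.1 * V ω + lam.2 * (V ω * U ω) - Z ω) 0) ^ 2 ∂ℙ) :
    ContDiff ℝ 2 G ∧
    ∃ a A : ℝ, 0 < a ∧ a ≤ A ∧
      ConvexOn ℝ Set.univ (fun lam : ℝ × ℝ => G lam - a / 2 * (lam.1 ^ 2 + lam.2 ^ 2)) ∧
      ConvexOn ℝ Set.univ (fun lam : ℝ × ℝ => A / 2 * (lam.1 ^ 2 + lam.2 ^ 2) - G lam) := by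
  have hU2 : Integrable (fun ω => U ω ^ 2) ℙ := by
    refine ((integrable_const (1 : ℝ)).add hU4).mono' (by fun_prop) (ae_of_all _ fun ω => ?_)
    rw [Real.norm_of_nonneg (sq_nonneg _)]
    simp only [Pi.add_apply]
    nlinarith [sq_nonneg (U ω ^ 2 - 1)]
  have hU1 : Integrable U ℙ :=
    ((memLp_two_iff_integrable_sq hUmeas.aestronglyMeasurable).2 hU2).integrable one_le_two
  have hVsq : ∀ ω, V ω ^ 2 = 1 := fun ω => by rcases hV ω with h | h <;> simp [h]
  -- The affine index `s = λ₀ + λ₁ U`, and its sign flip `V s`, as linear maps of `λ`.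
  let ℓ : ℝ → ℝ × ℝ →L[ℝ] ℝ := fun u =>
    ContinuousLinearMap.fst ℝ ℝ ℝ + u • ContinuousLinearMap.snd ℝ ℝ ℝ
  have hℓ : ∀ u (l : ℝ × ℝ), ℓ u l = l.1 + u * l.2 := fun u l => by simp [ℓ]
  have hs2 : ∀ l, Integrable (fun ω => ℓ (U ω) l ^ 2) ℙ := by
    intro l
    refine (((integrable_const (l.1 ^ 2)).add (hU1.const_mul (2 * (l.1 * l.2)))).add
      (hU2.const_mul (l.2 ^ 2))).congr (ae_of_all _ fun ω => ?_)
    simp only [Pi.add_apply, hℓ]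
    ring
  have hsV2 : ∀ l, Integrable (fun ω => (V ω * ℓ (U ω) l) ^ 2) ℙ := by
    simpa only [mul_pow, hVsq, one_mul] using hs2
  have hgint : ∀ T : Ω → ℝ, Measurable T → Integrable (fun ω => T ω ^ 2) ℙ →
      Integrable (fun ω => gaussianHingeSq (T ω)) ℙ := by
    intro T hT hT2
    refine (hT2.add (integrable_const (1 : ℝ))).mono'
      (continuous_gaussianHingeSq.measurable.comp hT).aestronglyMeasurable (ae_of_all _ fun ω => ?_)
    rw [Real.norm_of_nonneg (gaussianHingeSq_nonneg _)]
    exact gaussianHingeSq_le _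
  have hℓmeas : ∀ l, Measurable fun u => ℓ u l := fun l => by simp only [hℓ]; fun_prop
  have hsmeas : ∀ l, Measurable fun ω => ℓ (U ω) l := fun l => (hℓmeas l).comp hUmeas
  have hGV : ∀ l, G l = ∫ ω, gaussianHingeSq (V ω * ℓ (U ω) l) ∂ℙ := by
    intro l
    rw [hG, ← integral_hinge_sq_eq_integral_gaussianHingeSq (T := fun ω => V ω * ℓ (U ω) l)
      (hVmeas.mul (hsmeas l)) hZmeas (hsV2 l) hZlaw]
    · congr with ω
      rw [hℓ]
      ring_nf
    · exact hZindep.comp (φ := fun q : ℝ × ℝ => q.2 * ℓ q.1 l)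
        (measurable_snd.mul ((hℓmeas l).comp measurable_fst)) measurable_id
  have hGU : ∀ l, G l = ∫ ω, (pp (U ω) * gaussianHingeSq (ℓ (U ω) l)
      + (1 - pp (U ω)) * gaussianHingeSq (-ℓ (U ω) l)) ∂ℙ := by
    intro l
    have hfm : Measurable fun u => gaussianHingeSq (ℓ u l) :=
      continuous_gaussianHingeSq.measurable.comp (hℓmeas l)
    have hhm : Measurable fun u => gaussianHingeSq (-ℓ u l) :=
      continuous_gaussianHingeSq.measurable.comp (hℓmeas l).neg
    have hf := hgint _ (hsmeas l) (hs2 l)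
    have hh := hgint _ (hsmeas l).neg (by simpa using hs2 l)
    have hb : ∀ᵐ ω ∂(ℙ : Measure Ω), ‖pp (U ω)‖ ≤ 1 := ae_of_all _ fun ω => by
      rw [Real.norm_of_nonneg (hpprange _).1.le]; exact (hpprange _).2.le
    have hpm := (hppmeas.comp hUmeas).aestronglyMeasurable (μ := ℙ)
    classical
    rw [hGV, ← integral_ite_eq_integral_conditional hUmeas
      (measurableSet_eq_fun hVmeas measurable_const) hppmeas (fun t => (hpprange t).1.le) hcond
      hfm hhm hf hh (hh.bdd_mul hpm hb) (hf.bdd_mul hpm hb)]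
    congr with ω
    rcases hV ω with h | h
    · simp [h]
    · have : (-1 : ℝ) ≠ 1 := by norm_num
      simp [h, this]
  have hgconv : ∀ L : ℝ × ℝ →L[ℝ] ℝ, ConvexOn ℝ Set.univ fun l => gaussianHingeSq (L l) :=
    fun L => by
      simpa using! convexOn_gaussianHingeSq.comp_linearMap (L : ℝ × ℝ →ₗ[ℝ] ℝ)
  refine ⟨?_, ?_⟩
  · let L : Ω → ℝ × ℝ →L[ℝ] ℝ := fun ω => V ω • ℓ (U ω)
    have hLmeas : AEStronglyMeasurable L ℙ := by
      refine hVmeas.aestronglyMeasurable.smul ?_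
      exact aestronglyMeasurable_const.add
        (hUmeas.aestronglyMeasurable.smul aestronglyMeasurable_const)
    have hL2 : Integrable (fun ω => ‖L ω‖ ^ 2) ℙ := by
      refine (((integrable_const (1 : ℝ)).add hU2).const_mul 2).mono' (hLmeas.norm.pow 2)
        (ae_of_all _ fun ω => ?_)
      have h1 : ‖L ω‖ ≤ 1 + |U ω| := by
        have hVn : ‖V ω‖ = 1 := by rcases hV ω with h | h <;> simp [h]
        rw [norm_smul, hVn, one_mul]
        refine (norm_add_le _ _).trans (add_le_add (ContinuousLinearMap.norm_fst_le ..) ?_)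
        rw [norm_smul]
        exact mul_le_of_le_one_right (norm_nonneg _) (ContinuousLinearMap.norm_snd_le ..)
      rw [Real.norm_of_nonneg (sq_nonneg _)]
      simp only [Pi.add_apply]
      nlinarith [pow_le_pow_left₀ (norm_nonneg _) h1 2, sq_abs (U ω), sq_nonneg (1 - |U ω|)]
    rw [show G = fun l => ∫ ω, gaussianHingeSq (L ω l) ∂ℙ from funext hGV]
    refine contDiff_two_integral_comp_clm (K := 2) hLmeas hL2 hasDerivAt_gaussianHingeSq
      hasDerivAt_gaussianHinge continuous_gaussianStep (fun t => ?_) abs_gaussianHinge_le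
      abs_gaussianStep_le
    rw [abs_of_nonneg (gaussianHingeSq_nonneg t)]
    nlinarith [gaussianHingeSq_le t, sq_nonneg t]
  · let m : ℝ → ℝ := fun t => min (pp t) (1 - pp t)
    have hm0 : ∀ t, 0 < m t := fun t => lt_min (hpprange t).1 (by linarith [(hpprange t).2])
    have hm1 : ∀ t, m t ≤ 1 := fun t => (min_le_left _ _).trans (hpprange t).2.le
    have hmmeas : Measurable fun ω => m (U ω) := by fun_prop
    have hmb : ∀ᵐ ω ∂(ℙ : Measure Ω), ‖m (U ω)‖ ≤ 1 := ae_of_all _ fun ω => by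
      rw [Real.norm_of_nonneg (hm0 _).le]; exact hm1 _
    obtain ⟨hα, hdet⟩ := sq_integral_mul_lt_integral_mul_integral hU2 hUmeas hmmeas
      (fun ω => hm0 _) (fun ω => hm1 _) hUnondeg
    have i0 : Integrable (fun ω => m (U ω)) ℙ :=
      (integrable_const (1 : ℝ)).mono' hmmeas.aestronglyMeasurable hmb
    have i1 : Integrable (fun ω => m (U ω) * U ω) ℙ :=
      hU1.bdd_mul hmmeas.aestronglyMeasurable hmb
    have i2 : Integrable (fun ω => m (U ω) * U ω ^ 2) ℙ :=
      hU2.bdd_mul hmmeas.aestronglyMeasurable hmb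
    set α := ∫ ω, m (U ω) ∂ℙ
    set β := ∫ ω, m (U ω) * U ω ∂ℙ
    set δ := ∫ ω, m (U ω) * U ω ^ 2 ∂ℙ
    have hδ : 0 < δ := by
      by_contra! h
      nlinarith [sq_nonneg β, mul_nonneg hα.le (neg_nonneg.2 h)]
    have hms2 : ∀ l, Integrable (fun ω => m (U ω) * ℓ (U ω) l ^ 2) ℙ := fun l =>
      (hs2 l).bdd_mul hmmeas.aestronglyMeasurable hmb
    have hQ : ∀ l : ℝ × ℝ, ∫ ω, m (U ω) * ℓ (U ω) l ^ 2 ∂ℙ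
        = α * l.1 ^ 2 + 2 * β * (l.1 * l.2) + δ * l.2 ^ 2 := by
      intro l
      rw [mul_comm 2 β, mul_assoc, ← integral_mul_const, ← integral_mul_const,
        ← integral_mul_const, ← integral_add (i0.mul_const _) (i1.mul_const _),
        ← integral_add (f := fun ω => m (U ω) * l.1 ^ 2 + m (U ω) * U ω * (2 * (l.1 * l.2)))
          ((i0.mul_const _).add (i1.mul_const _)) (i2.mul_const _)]
      congr with ω
      rw [hℓ]
      ring
    have hQ2 : ∀ l : ℝ × ℝ, ∫ ω, ℓ (U ω) l ^ 2 ∂ℙ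
        = l.1 ^ 2 + 2 * (∫ ω, U ω ∂ℙ) * (l.1 * l.2) + (∫ ω, U ω ^ 2 ∂ℙ) * l.2 ^ 2 := by
      intro l
      have hc : ∫ _, l.1 ^ 2 ∂(ℙ : Measure Ω) = l.1 ^ 2 := by simp
      rw [← hc, mul_comm 2 (∫ ω, U ω ∂ℙ), mul_assoc, ← integral_mul_const,
        ← integral_mul_const, ← integral_add (integrable_const _) (hU1.mul_const _),
        ← integral_add (f := fun ω => l.1 ^ 2 + U ω * (2 * (l.1 * l.2)))
          ((integrable_const _).add (hU1.mul_const _)) (hU2.mul_const _)]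
      congr with ω
      rw [hℓ]
      ring
    have hlower : ConvexOn ℝ Set.univ
        fun l : ℝ × ℝ => G l - (α * l.1 ^ 2 + 2 * β * (l.1 * l.2) + δ * l.2 ^ 2) := by
      have hpb : ∀ ω, ‖pp (U ω) - m (U ω)‖ ≤ 1 := fun ω => by
        have := min_le_left (pp (U ω)) (1 - pp (U ω))
        rw [Real.norm_of_nonneg (sub_nonneg.2 this)]
        linarith [hm0 (U ω), (hpprange (U ω)).2]
      have hqb : ∀ ω, ‖1 - pp (U ω) - m (U ω)‖ ≤ 1 := fun ω => by
        have := min_le_right (pp (U ω)) (1 - pp (U ω))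
        rw [Real.norm_of_nonneg (sub_nonneg.2 this)]
        linarith [hm0 (U ω), (hpprange (U ω)).1]
      have hint : ∀ l ∈ (Set.univ : Set (ℝ × ℝ)), Integrable (fun ω =>
          (pp (U ω) - m (U ω)) * gaussianHingeSq (ℓ (U ω) l)
            + (1 - pp (U ω) - m (U ω)) * gaussianHingeSq ((-ℓ (U ω)) l) + m (U ω)) ℙ := fun l _ =>
        (((hgint _ (hsmeas l) (hs2 l)).bdd_mul (by fun_prop) (ae_of_all _ hpb)).add
          ((hgint _ (hsmeas l).neg (by simpa using hs2 l)).bdd_mul (by fun_prop)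
            (ae_of_all _ hqb))).add i0
      have hconv := integral_convexOn_of_integrand_ae convex_univ (ae_of_all (ℙ : Measure Ω)
        fun ω => (((hgconv (ℓ (U ω))).smul
          (sub_nonneg.2 (min_le_left (pp (U ω)) (1 - pp (U ω))))).add
          ((hgconv (-ℓ (U ω))).smul
          (sub_nonneg.2 (min_le_right (pp (U ω)) (1 - pp (U ω)))))).add_const (m (U ω))) hint
      refine hconv.congr fun l hl => ?_
      have hsum : G l = ∫ ω, ((pp (U ω) - m (U ω)) * gaussianHingeSq (ℓ (U ω) l)
            + (1 - pp (U ω) - m (U ω)) * gaussianHingeSq ((-ℓ (U ω)) l) + m (U ω)) ∂ℙ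
            + ∫ ω, m (U ω) * ℓ (U ω) l ^ 2 ∂ℙ := by
        rw [hGU, ← integral_add (hint l hl) (hms2 l)]
        congr with ω
        rw [neg_apply]
        linear_combination m (U ω) * gaussianHingeSq_add_neg (ℓ (U ω) l)
      rw [← hQ, hsum]
      exact (add_sub_cancel_right _ _).symm
    have hupper : ConvexOn ℝ Set.univ fun l : ℝ × ℝ => l.1 ^ 2 + 2 * (∫ ω, U ω ∂ℙ) * (l.1 * l.2)
        + (∫ ω, U ω ^ 2 ∂ℙ) * l.2 ^ 2 - G l := by
      have hint : ∀ l ∈ (Set.univ : Set (ℝ × ℝ)), Integrable (fun ω =>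
          gaussianHingeSq ((-(V ω • ℓ (U ω))) l) + -1) ℙ := fun l _ =>
        (hgint (fun ω => (-(V ω • ℓ (U ω))) l) (hVmeas.mul (hsmeas l)).neg
          (by simpa using hsV2 l)).add (integrable_const _)
      have hconv := integral_convexOn_of_integrand_ae convex_univ (ae_of_all (ℙ : Measure Ω)
        fun ω => (hgconv (-(V ω • ℓ (U ω)))).add_const (-1)) hint
      refine hconv.congr fun l hl => ?_
      rw [← hQ2, hGV, ← integral_sub (hs2 l) (hgint (fun ω => V ω * ℓ (U ω) l)
        (hVmeas.mul (hsmeas l)) (hsV2 l))]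
      refine integral_congr_ae (ae_of_all _ fun ω => ?_)
      have h := gaussianHingeSq_add_neg (V ω * ℓ (U ω) l)
      rw [mul_pow, hVsq] at h
      simp only [Pi.add_apply, neg_apply, smul_apply,
        smul_eq_mul]
      linarith
    have hvar : (∫ ω, U ω ∂ℙ) ^ 2 ≤ ∫ ω, U ω ^ 2 ∂ℙ := by
      have h := variance_nonneg U ℙ
      rw [variance_eq_sub ((memLp_two_iff_integrable_sq hUmeas.aestronglyMeasurable).2 hU2)] at h
      simpa using h
    set b := ∫ ω, U ω ∂ℙ
    set M := ∫ ω, U ω ^ 2 ∂ℙ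
    have hM : 0 ≤ M := (sq_nonneg b).trans hvar
    -- A lower bound for the least eigenvalue of the weighted moment matrix.
    let e := (α * δ - β ^ 2) / (α + δ)
    have he : 0 < e := div_pos (by linarith) (by linarith)
    have hee : e * (α + δ) = α * δ - β ^ 2 := div_mul_cancel₀ _ (by positivity)
    have heα : e ≤ α := by
      rw [div_le_iff₀ (by positivity)]; nlinarith [sq_nonneg β, sq_nonneg α]
    have heδ : e ≤ δ := by
      rw [div_le_iff₀ (by positivity)]; nlinarith [sq_nonneg β, sq_nonneg δ]
    refine ⟨2 * e, 2 * (1 + M + e), by linarith, by linarith, ?_, ?_⟩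
    · refine (hlower.add (convexOn_quadraticForm_prod (a := α - e) (b := β) (c := δ - e)
        (by linarith) (by linarith) (by nlinarith [sq_nonneg e]))).congr fun l _ => ?_
      simp only [Pi.add_apply]
      ring
    · refine (hupper.add (convexOn_quadraticForm_prod (a := M + e) (b := -b) (c := 1 + e)
        (by linarith) (by linarith) (by nlinarith [mul_nonneg hM he.le]))).congr fun l _ => ?_
      simp only [Pi.add_apply]
      ring
end

section
/- Let U be a real random variable with E[U⁴] < ∞ whose law is not a point mass, let V ∈ {−1,1} satisfy ℙ(V = 1 | U) = p₊(U) for a measurable p₊ : ℝ → (0,1), set Y := V and X := V·U, and let Z ∼ N(0,1) be independent of (U, V). Then the function G(λ₀, λ₁) := E[((λ₀Y + λ₁X − Z)₊)²] attains its infimum over ℝ², and its global minimizer λ* ∈ ℝ² is unique. -/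
open MeasureTheory ProbabilityTheory
open scoped ProbabilityTheory


/-- The expected squared positive part of an affine combination `l₀ a + l₁ b - c`. -/
noncomputable def posPartSqIntegral {Ω : Type*} [MeasurableSpace Ω] (μ : Measure Ω)
    (a b c : Ω → ℝ) (l : ℝ × ℝ) : ℝ :=
  ∫ ω, (max (l.1 * a ω + l.2 * b ω - c ω) 0) ^ 2 ∂μ

lemma sq_max_zero_convexOn : ConvexOn ℝ Set.univ (fun t : ℝ => (max t 0) ^ 2) := by
  have h : ConvexOn ℝ Set.univ (fun t : ℝ => max t 0) :=
    (convexOn_id convex_univ).sup (convexOn_const 0 convex_univ)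
  exact h.pow (fun _ _ => le_max_right _ _) 2

/-- If the squared positive part is affine between `x` and `y` at their midpoint and `y` is
positive, then `x = y`. -/
lemma eq_of_sq_max_zero_midpoint {x y : ℝ} (hy : 0 < y)
    (h : (max x 0) ^ 2 + (max y 0) ^ 2 ≤ 2 * (max ((x + y) / 2) 0) ^ 2) : x = y := by
  rw [max_eq_left hy.le] at h
  have hm : max ((x + y) / 2) 0 ≤ (max x 0 + y) / 2 := by
    apply max_le
    · linarith [le_max_left x 0]
    · linarith [le_max_right x 0]
  have hsq : (max ((x + y) / 2) 0) ^ 2 ≤ ((max x 0 + y) / 2) ^ 2 :=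
    pow_le_pow_left₀ (le_max_right _ _) hm 2
  have heq : max x 0 = y := by
    have : (max x 0 - y) ^ 2 = 0 := le_antisymm (by nlinarith) (sq_nonneg _)
    linarith [pow_eq_zero_iff (two_ne_zero) |>.1 this]
  rcases max_choice x 0 with h' | h' <;> linarith

section PosPartSqIntegral

variable {Ω : Type*} [MeasurableSpace Ω] {μ : Measure Ω} {a b c : Ω → ℝ}

lemma integrable_posPartSq (ha : MemLp a 2 μ) (hb : MemLp b 2 μ) (hc : MemLp c 2 μ)
    (l : ℝ × ℝ) :
    Integrable (fun ω => (max (l.1 * a ω + l.2 * b ω - c ω) 0) ^ 2) μ :=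
  MemLp.integrable_sq (((ha.const_mul l.1).add (hb.const_mul l.2)).sub hc).pos_part

lemma convexOn_posPartSqIntegral (ha : MemLp a 2 μ) (hb : MemLp b 2 μ) (hc : MemLp c 2 μ) :
    ConvexOn ℝ Set.univ (posPartSqIntegral μ a b c) := by
  refine ⟨convex_univ, fun x _ y _ s t hs ht hst => ?_⟩
  have hx := integrable_posPartSq ha hb hc x
  have hy := integrable_posPartSq ha hb hc y
  simp only [posPartSqIntegral, smul_eq_mul]
  rw [← integral_const_mul, ← integral_const_mul,
    ← integral_add (hx.const_mul s) (hy.const_mul t)]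
  refine integral_mono (integrable_posPartSq ha hb hc _)
    ((hx.const_mul s).add (hy.const_mul t)) fun ω => ?_
  have h := sq_max_zero_convexOn.2 (Set.mem_univ (x.1 * a ω + x.2 * b ω - c ω))
    (Set.mem_univ (y.1 * a ω + y.2 * b ω - c ω)) hs ht hst
  simp only [smul_eq_mul] at h
  convert h using 3
  simp only [Prod.fst_add, Prod.snd_add, Prod.smul_fst, Prod.smul_snd, smul_eq_mul]
  linear_combination c ω * hst

lemma continuous_posPartSqIntegral (ha : MemLp a 2 μ) (hb : MemLp b 2 μ) (hc : MemLp c 2 μ) :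
    Continuous (posPartSqIntegral μ a b c) := by
  rw [← continuousOn_univ]
  exact (convexOn_posPartSqIntegral ha hb hc).continuousOn isOpen_univ

lemma posPartSqIntegral_zero_smul (r : ℝ) (hr : 0 ≤ r) (l : ℝ × ℝ) :
    posPartSqIntegral μ a b 0 (r • l) = r ^ 2 * posPartSqIntegral μ a b 0 l := by
  simp only [posPartSqIntegral, ← integral_const_mul]
  congr 1 with ω
  rw [← mul_pow, mul_max_of_nonneg _ _ hr]
  congr 2
  · simp; ring
  · simp

/-- A homogeneous quadratic functional that is positive off the origin tends to infinity. -/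
lemma tendsto_posPartSqIntegral_zero (ha : MemLp a 2 μ) (hb : MemLp b 2 μ)
    (hpos : ∀ l ≠ 0, 0 < posPartSqIntegral μ a b 0 l) :
    Filter.Tendsto (posPartSqIntegral μ a b 0) (Filter.cocompact (ℝ × ℝ)) Filter.atTop := by
  have hcont := continuous_posPartSqIntegral ha hb (MemLp.zero (ε := ℝ) (p := 2) (μ := μ))
  have hne : (Metric.sphere (0 : ℝ × ℝ) 1).Nonempty := ⟨(1, 0), by simp [Prod.norm_def]⟩
  obtain ⟨m, hm, hmin⟩ := (isCompact_sphere (0 : ℝ × ℝ) 1).exists_isMinOn hne hcont.continuousOn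
  have hmpos := hpos m (by rintro rfl; simp at hm)
  have hlim : Filter.Tendsto (fun l : ℝ × ℝ => ‖l‖ ^ 2 * posPartSqIntegral μ a b 0 m)
      (Filter.cocompact (ℝ × ℝ)) Filter.atTop :=
    ((Filter.tendsto_pow_atTop two_ne_zero).comp
      (tendsto_norm_cocompact_atTop (E := ℝ × ℝ))).atTop_mul_const hmpos
  refine Filter.tendsto_atTop_mono (fun l => ?_) hlim
  rcases eq_or_ne l 0 with rfl | hl
  · simp [posPartSqIntegral]
  · have hn : ‖l‖ ≠ 0 := norm_ne_zero_iff.2 hl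
    have h1 : l = ‖l‖ • (‖l‖⁻¹ • l) := by rw [smul_smul, mul_inv_cancel₀ hn, one_smul]
    conv_rhs => rw [h1, posPartSqIntegral_zero_smul _ (norm_nonneg _)]
    refine mul_le_mul_of_nonneg_left (hmin ?_) (by positivity)
    simp [norm_smul, hn]

/-- Two minimizers agree almost everywhere on the event where the second one is active. -/
lemma ae_eq_of_forall_posPartSqIntegral_le (ha : MemLp a 2 μ) (hb : MemLp b 2 μ)
    (hc : MemLp c 2 μ) {x y : ℝ × ℝ}
    (hx : ∀ l, posPartSqIntegral μ a b c x ≤ posPartSqIntegral μ a b c l)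
    (hy : ∀ l, posPartSqIntegral μ a b c y ≤ posPartSqIntegral μ a b c l) :
    ∀ᵐ ω ∂μ, c ω < y.1 * a ω + y.2 * b ω →
      x.1 * a ω + x.2 * b ω = y.1 * a ω + y.2 * b ω := by
  set m : ℝ × ℝ := ((x.1 + y.1) / 2, (x.2 + y.2) / 2) with hm
  have ix := integrable_posPartSq ha hb hc x
  have iy := integrable_posPartSq ha hb hc y
  have im := integrable_posPartSq ha hb hc m
  have hmid (ω : Ω) : m.1 * a ω + m.2 * b ω - c ω =
      ((x.1 * a ω + x.2 * b ω - c ω) + (y.1 * a ω + y.2 * b ω - c ω)) / 2 := by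
    simp only [hm]; ring
  let f : Ω → ℝ := fun ω => (max (x.1 * a ω + x.2 * b ω - c ω) 0) ^ 2
    + (max (y.1 * a ω + y.2 * b ω - c ω) 0) ^ 2
    - 2 * (max (m.1 * a ω + m.2 * b ω - c ω) 0) ^ 2
  have hf0 : 0 ≤ f := fun ω => by
    have h := sq_max_zero_convexOn.2 (Set.mem_univ (x.1 * a ω + x.2 * b ω - c ω))
      (Set.mem_univ (y.1 * a ω + y.2 * b ω - c ω)) (by norm_num : (0 : ℝ) ≤ 1 / 2)
      (by norm_num : (0 : ℝ) ≤ 1 / 2) (by norm_num)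
    simp only [smul_eq_mul, ← mul_add] at h
    rw [one_div_mul_eq_div, ← hmid ω] at h
    simp only [Pi.zero_apply, f]
    linarith
  have hfi : Integrable f μ := (ix.add iy).sub (im.const_mul 2)
  have hfint : ∫ ω, f ω ∂μ = 0 := by
    refine le_antisymm ?_ (integral_nonneg hf0)
    have h : ∫ ω, f ω ∂μ = posPartSqIntegral μ a b c x + posPartSqIntegral μ a b c y
        - 2 * posPartSqIntegral μ a b c m := by
      simp only [posPartSqIntegral, f]
      have ixy : Integrable (fun ω => (max (x.1 * a ω + x.2 * b ω - c ω) 0) ^ 2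
        + (max (y.1 * a ω + y.2 * b ω - c ω) 0) ^ 2) μ := ix.add iy
      rw [integral_sub ixy (im.const_mul 2), integral_add ix iy, integral_const_mul]
    linarith [hx m, hy m]
  filter_upwards [(integral_eq_zero_iff_of_nonneg hf0 hfi).1 hfint] with ω hω hlt
  have h := eq_of_sq_max_zero_midpoint (x := x.1 * a ω + x.2 * b ω - c ω) (sub_pos.2 hlt)
    (by rw [← hmid ω]; simp only [Pi.zero_apply, f] at hω; linarith)
  linarith

end PosPartSqIntegral

/-- An event independent of a standard Gaussian variable is null as soon as its part on which
the Gaussian variable lies below some level is null. -/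
lemma measure_preimage_eq_zero_of_inter_gaussian {Ω E : Type*} [MeasurableSpace Ω]
    [MeasurableSpace E] {μ : Measure Ω} {W : Ω → E} {Z : Ω → ℝ} (hZ : Measurable Z)
    (hlaw : μ.map Z = gaussianReal 0 1) (hind : IndepFun W Z μ) {S : Set E}
    (hS : MeasurableSet S) (c : ℝ) (h : μ (W ⁻¹' S ∩ Z ⁻¹' Set.Iio c) = 0) :
    μ (W ⁻¹' S) = 0 := by
  rw [hind.measure_inter_preimage_eq_mul _ _ hS measurableSet_Iio,
    ← Measure.map_apply hZ measurableSet_Iio, hlaw] at h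
  refine (mul_eq_zero.1 h).resolve_right fun h0 => ?_
  have := gaussianReal_absolutelyContinuous' 0 one_ne_zero h0
  simp at this

/-- A nondegenerate real variable satisfies no nontrivial affine relation. -/
lemma eq_zero_of_ae_affine_eq_zero {Ω : Type*} [MeasurableSpace Ω] {μ : Measure Ω}
    [IsProbabilityMeasure μ] {U : Ω → ℝ} (hU : ∀ c : ℝ, μ.map U ≠ Measure.dirac c)
    {p q : ℝ} (h : ∀ᵐ ω ∂μ, p + q * U ω = 0) : p = 0 ∧ q = 0 := by
  have hq : q = 0 := by
    by_contra hq
    refine hU (-p / q) ?_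
    have : U =ᵐ[μ] fun _ => -p / q := by
      filter_upwards [h] with ω hω
      field_simp
      linarith
    rw [Measure.map_congr this, Measure.map_const]
    simp
  obtain ⟨ω, hω⟩ := h.exists
  subst hq
  simpa using hω

/-- If both signs of `V` have positive conditional probability given `U`, then a set of values of
`U` that almost surely excludes one of the signs is null. -/
lemma measure_preimage_eq_zero_of_inter_sign {Ω : Type*} [MeasurableSpace Ω] {μ : Measure Ω}
    [IsFiniteMeasure μ] {U V : Ω → ℝ} (hU : Measurable U)
    (hV : ∀ ω, V ω = 1 ∨ V ω = -1) {pp : ℝ → ℝ} (hpp : Measurable pp)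
    (hpr : ∀ t, pp t ∈ Set.Ioo (0 : ℝ) 1)
    (hcond : ∀ B : Set ℝ, MeasurableSet B →
      μ ({ω | V ω = 1} ∩ U ⁻¹' B) = ∫⁻ ω in U ⁻¹' B, ENNReal.ofReal (pp (U ω)) ∂μ)
    {B : Set ℝ} (hB : MeasurableSet B) {v : ℝ} (hv : v = 1 ∨ v = -1)
    (h : μ ({ω | V ω = v} ∩ U ⁻¹' B) = 0) : μ (U ⁻¹' B) = 0 := by
  have hm : Measurable fun ω => ENNReal.ofReal (pp (U ω)) := (hpp.comp hU).ennreal_ofReal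
  rcases hv with rfl | rfl
  · rw [hcond B hB, lintegral_eq_zero_iff hm] at h
    have hF : ∀ᵐ ω ∂μ.restrict (U ⁻¹' B), False := by
      filter_upwards [h] with ω hω
      have := (hpr (U ω)).1
      simp only [Pi.zero_apply, ENNReal.ofReal_eq_zero] at hω
      linarith
    simpa using hF
  · have hsum : μ (U ⁻¹' B) = μ ({ω | V ω = 1} ∩ U ⁻¹' B) := by
      refine le_antisymm ?_ (measure_mono Set.inter_subset_right)
      calc μ (U ⁻¹' B) ≤ μ (({ω | V ω = 1} ∩ U ⁻¹' B) ∪ ({ω | V ω = -1} ∩ U ⁻¹' B)) := by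
            refine measure_mono fun ω hω => ?_
            rcases hV ω with h1 | h1
            · exact Or.inl ⟨h1, hω⟩
            · exact Or.inr ⟨h1, hω⟩
        _ ≤ _ := measure_union_le _ _
        _ = _ := by rw [h, add_zero]
    by_contra hne
    have hlt : ∫⁻ ω in U ⁻¹' B, ENNReal.ofReal (pp (U ω)) ∂μ < ∫⁻ ω in U ⁻¹' B, 1 ∂μ := by
      refine lintegral_strict_mono (by simpa using hne) aemeasurable_const ?_ ?_
      · rw [← hcond B hB]; exact measure_ne_top _ _
      · filter_upwards with ω
        rw [← ENNReal.ofReal_one]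
        exact (ENNReal.ofReal_lt_ofReal_iff one_pos).2 (hpr (U ω)).2
    rw [← hcond B hB, ← hsum] at hlt
    simp at hlt

/- STATEMENT 9: With E[U⁴] < ∞, U non-degenerate, V ∈ {−1,1} with ℙ(V = 1 | U) = p₊(U),
Y = V, X = V·U, and Z ∼ N(0,1) independent of (U, V), the function
G(λ₀, λ₁) = E[((λ₀Y + λ₁X − Z)₊)²] attains its infimum over ℝ² and its global minimizer
is unique. -/
theorem G_has_unique_minimizer
    (Ω : Type*) [MeasureSpace Ω] [IsProbabilityMeasure (ℙ : Measure Ω)]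
    (U V Z : Ω → ℝ)
    (hUmeas : Measurable U) (hVmeas : Measurable V) (hZmeas : Measurable Z)
    (hU4 : Integrable (fun ω => (U ω) ^ 4) ℙ)
    (hUnondeg : ∀ c : ℝ, Measure.map U ℙ ≠ Measure.dirac c)
    (hV : ∀ ω, V ω = 1 ∨ V ω = -1)
    (pp : ℝ → ℝ) (hppmeas : Measurable pp) (hpprange : ∀ t, pp t ∈ Set.Ioo (0 : ℝ) 1)
    (hcond : ∀ B : Set ℝ, MeasurableSet B →
      ℙ ({ω | V ω = 1} ∩ U ⁻¹' B)
        = ∫⁻ ω in U ⁻¹' B, ENNReal.ofReal (pp (U ω)) ∂ℙ)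
    (hZlaw : Measure.map Z ℙ = gaussianReal 0 1)
    (hZindep : IndepFun (fun ω => (U ω, V ω)) Z ℙ)
    (G : ℝ × ℝ → ℝ)
    (hG : ∀ lam : ℝ × ℝ,
      G lam = ∫ ω, (max (lam.1 * V ω + lam.2 * (V ω * U ω) - Z ω) 0) ^ 2 ∂ℙ) :
    ∃! lamStar : ℝ × ℝ, ∀ lam : ℝ × ℝ, G lamStar ≤ G lam := by
  have hVb : ∀ ω, ‖V ω‖ ≤ 1 := fun ω => by rcases hV ω with h | h <;> simp [h]
  have hUL : MemLp U 2 ℙ := by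
    rw [memLp_two_iff_integrable_sq hUmeas.aestronglyMeasurable]
    refine ((integrable_const (1 : ℝ)).add hU4).mono'
      (hUmeas.pow_const 2).aestronglyMeasurable (Filter.Eventually.of_forall fun ω => ?_)
    simp only [Real.norm_eq_abs, abs_pow, sq_abs, Pi.add_apply]
    nlinarith [sq_nonneg (U ω ^ 2 - 1), sq_nonneg (U ω ^ 2)]
  have hVL : MemLp V 2 ℙ :=
    MemLp.of_bound hVmeas.aestronglyMeasurable 1 (Filter.Eventually.of_forall hVb)
  have hVUL : MemLp (fun ω => V ω * U ω) 2 ℙ :=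
    hUL.mono (hVmeas.mul hUmeas).aestronglyMeasurable (Filter.Eventually.of_forall fun ω => by
      rw [norm_mul]; exact mul_le_of_le_one_left (norm_nonneg _) (hVb ω))
  have hZL : MemLp Z 2 ℙ := by
    have h : MemLp id 2 (Measure.map Z ℙ) := hZlaw ▸ memLp_id_gaussianReal' 2 (by simp)
    exact h.comp_of_map hZmeas.aemeasurable
  obtain rfl : G = posPartSqIntegral ℙ V (fun ω => V ω * U ω) Z := funext hG
  set N : Set Ω := Z ⁻¹' Set.Iio 0 with hN
  have hNm : MeasurableSet N := hZmeas measurableSet_Iio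
  have hcont := continuous_posPartSqIntegral hVL hVUL hZL
  have hle : ∀ l, posPartSqIntegral (Measure.restrict ℙ N) V (fun ω => V ω * U ω) 0 l ≤
      posPartSqIntegral ℙ V (fun ω => V ω * U ω) Z l := fun l => by
    have hi := integrable_posPartSq hVL hVUL hZL l
    refine le_trans (setIntegral_mono_on
      (integrable_posPartSq hVL hVUL MemLp.zero l).integrableOn hi.integrableOn hNm fun ω hω => ?_)
      (setIntegral_le_integral hi (Filter.Eventually.of_forall fun ω => sq_nonneg _))
    have : Z ω < 0 := hω
    refine pow_le_pow_left₀ (le_max_right _ _) (max_le_max ?_ le_rfl) 2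
    simp only [Pi.zero_apply]
    linarith
  have hpos : ∀ l ≠ 0,
      0 < posPartSqIntegral (Measure.restrict ℙ N) V (fun ω => V ω * U ω) 0 l := by
    intro l hl
    have hnn : ∀ ω, 0 ≤ (max (l.1 * V ω + l.2 * (V ω * U ω) - (0 : Ω → ℝ) ω) 0) ^ 2 :=
      fun ω => sq_nonneg _
    refine lt_of_le_of_ne (integral_nonneg hnn) fun h0 => hl ?_
    have hae := (integral_eq_zero_iff_of_nonneg hnn
      (integrable_posPartSq hVL hVUL MemLp.zero l).restrict).1 h0.symm
    rw [Filter.EventuallyEq, ae_restrict_iff' hNm] at hae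
    have hnull (v : ℝ) (hv : v = 1 ∨ v = -1) : ℙ (U ⁻¹' {u | 0 < v * (l.1 + l.2 * u)}) = 0 := by
      have hBm : MeasurableSet {u : ℝ | 0 < v * (l.1 + l.2 * u)} :=
        measurableSet_lt measurable_const (by fun_prop)
      refine measure_preimage_eq_zero_of_inter_sign hUmeas hV hppmeas hpprange hcond
        hBm hv ?_
      have h := measure_preimage_eq_zero_of_inter_gaussian hZmeas hZlaw hZindep
        (S := {w | w.2 = v} ∩ Prod.fst ⁻¹' {u | 0 < v * (l.1 + l.2 * u)})
        ((measurable_snd (measurableSet_singleton v)).inter (measurable_fst hBm)) 0 ?_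
      · exact h
      · refine measure_mono_null ?_ (ae_iff.1 hae)
        rintro ω ⟨⟨h1, h2⟩, h3⟩ hcon
        have h4 := hcon h3
        simp only [Set.mem_ofPred_eq, Set.mem_preimage] at h1 h2
        simp only [Pi.zero_apply, sub_zero, ne_eq, OfNat.ofNat_ne_zero, not_false_eq_true,
          pow_eq_zero_iff, max_eq_right_iff] at h4
        rw [h1] at h4
        linarith
    have hae0 : ∀ᵐ ω ∂ℙ, l.1 + l.2 * U ω = 0 := by
      have h1 := hnull 1 (Or.inl rfl)
      have h2 := hnull (-1) (Or.inr rfl)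
      rw [measure_eq_zero_iff_ae_notMem] at h1 h2
      filter_upwards [h1, h2] with ω h1 h2
      simp only [Set.mem_preimage, Set.mem_ofPred_eq, not_lt] at h1 h2
      linarith
    obtain ⟨h1, h2⟩ := eq_zero_of_ae_affine_eq_zero hUnondeg hae0
    exact Prod.ext h1 h2
  have hlim := Filter.tendsto_atTop_mono hle
    (tendsto_posPartSqIntegral_zero (hVL.restrict N) (hVUL.restrict N) hpos)
  obtain ⟨x, hx⟩ := hcont.exists_forall_le hlim
  refine ⟨x, hx, fun y hy => ?_⟩
  have hae := ae_eq_of_forall_posPartSqIntegral_le hVL hVUL hZL hy hx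
  have hnull (n : ℕ) : ℙ ((fun ω => (U ω, V ω)) ⁻¹' {w : ℝ × ℝ |
      (y.1 - x.1) + (y.2 - x.2) * w.1 ≠ 0 ∧ -(n : ℝ) < x.1 * w.2 + x.2 * (w.2 * w.1)}) = 0 := by
    refine measure_preimage_eq_zero_of_inter_gaussian hZmeas hZlaw hZindep ?_ (-(n : ℝ)) ?_
    · exact (measurableSet_eq_fun (f := fun w : ℝ × ℝ => (y.1 - x.1) + (y.2 - x.2) * w.1)
        (by fun_prop) measurable_const).compl.inter
        (measurableSet_lt (g := fun w : ℝ × ℝ => x.1 * w.2 + x.2 * (w.2 * w.1))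
          measurable_const (by fun_prop))
    · refine measure_mono_null ?_ (ae_iff.1 hae)
      rintro ω ⟨⟨h1, h2⟩, h3⟩ hcon
      have h4 := hcon (lt_trans h3 h2)
      apply h1
      simp only
      rcases hV ω with hv | hv <;> rw [hv] at h4 <;> linarith
  have hae0 : ∀ᵐ ω ∂ℙ, (y.1 - x.1) + (y.2 - x.2) * U ω = 0 := by
    simp only [measure_eq_zero_iff_ae_notMem] at hnull
    filter_upwards [ae_all_iff.2 hnull] with ω hω
    obtain ⟨n, hn⟩ := exists_nat_gt (-(x.1 * V ω + x.2 * (V ω * U ω)))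
    by_contra hne
    exact hω n ⟨hne, by simp only; linarith⟩
  obtain ⟨h1, h2⟩ := eq_zero_of_ae_affine_eq_zero hUnondeg hae0
  exact Prod.ext (sub_eq_zero.1 h1) (sub_eq_zero.1 h2)
end
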